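/- Let s ∈ ℝ and let ℂ₊ := {z ∈ ℂ : Im z > 0}. Let H be a semi-Hilbert space of holomorphic functions on ℂ₊ such that: (i) there is f ∈ H with ‖f‖_H ≠ 0; (ii) (strong decency) there exists a linear subspace V of Hol(ℂ₊), closed for the topology of uniform convergence on compact subsets, such that H ∩ V = {f ∈ H : ‖f‖_H = 0} and the canonical map H → Hol(ℂ₊)/V (with the quotient topology) is continuous; (iii) for every x ∈ ℝ the map f ↦ f(· + x) and for every λ > 0 the map f ↦ λ^{s/2}·f(λ·) send H into H and preserve the semi-inner product ⟨·,·⟩_H. Then there exist k ∈ ℕ with s + 2k ≥ 0 and c > 0 such that: (a) every f ∈ H whose k-th derivative vanishes identically on ℂ₊ satisfies ‖f‖_H = 0; (b) for every w ∈ ℂ₊ there exists h_w ∈ H with h_w^{(k)}(z) = c·((z − conj(w))/(2i))^{−(s+2k)} (principal power) for all z ∈ ℂ₊, and f^{(k)}(w) = ⟨f, h_w⟩_H for every f ∈ H. In particular, H embeds as a dense subspace, with proportional seminorms, of the space 𝒜_{s,k} of holomorphic functions on ℂ₊ whose k-th derivative lies in the reproducing kernel Hilbert space with kernel ((z − conj(w))/(2i))^{−(s+2k)}.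 -/

import Mathlib

noncomputable section

open Complex

/-- The upper half-plane `ℂ₊`. -/
def CPos : Set ℂ := {z | 0 < z.im}

/-- Translation `z ↦ z + x` of the upper half-plane. -/
def transH (x : ℝ) (z : ↥CPos) : ↥CPos :=
  ⟨(z : ℂ) + (x : ℂ), by
    have hz : 0 < (z : ℂ).im := z.2
    show 0 < ((z : ℂ) + (x : ℂ)).im
    simpa using hz⟩

/-- Dilation `z ↦ λ z` of the upper half-plane, `λ > 0`. -/
def dilH (l : ℝ) (hl : 0 < l) (z : ↥CPos) : ↥CPos :=
  ⟨(l : ℂ) * (z : ℂ), by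
    have hz : 0 < (z : ℂ).im := z.2
    show 0 < ((l : ℂ) * (z : ℂ)).im
    simpa [Complex.mul_im] using mul_pos hl hz⟩

/-- A function on `ℂ₊` is holomorphic if it is the restriction of a function
holomorphic on `ℂ₊`. -/
def HoloOnH (f : ↥CPos → ℂ) : Prop :=
  ∃ F : ℂ → ℂ, DifferentiableOn ℂ F CPos ∧ ∀ z : ↥CPos, F ↑z = f z

/-- Membership in the closure of a set of functions on `ℂ₊` for the topology of
uniform convergence on compact subsets. -/
def MemClosureH (S : Set (↥CPos → ℂ)) (f : ↥CPos → ℂ) : Prop :=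
  ∀ K : Set ↥CPos, IsCompact K → ∀ ε : ℝ, 0 < ε → ∃ g ∈ S, ∀ z ∈ K, ‖f z - g z‖ ≤ ε

open scoped Classical

/-- The complex derivative of a function on `ℂ₊`. -/
def pdH (f : ↥CPos → ℂ) (z : ↥CPos) : ℂ :=
  deriv (fun y : ℂ => if h : y ∈ CPos then f ⟨y, h⟩ else 0) (z : ℂ)

/-- The extension by zero to `ℂ` of a function on `ℂ₊`. -/
def extH (f : ↥CPos → ℂ) (y : ℂ) : ℂ := if h : y ∈ CPos then f ⟨y, h⟩ else 0

lemma extH_coe (f : ↥CPos → ℂ) (z : ↥CPos) : extH f z = f z := by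
  simp [extH]

lemma extH_of_mem (f : ↥CPos → ℂ) {z : ℂ} (hz : z ∈ CPos) : extH f z = f ⟨z, hz⟩ := by
  simp [extH, hz]

lemma isOpen_CPos : IsOpen CPos := isOpen_lt continuous_const Complex.continuous_im

lemma HoloOnH.differentiableOn {f : ↥CPos → ℂ} (hf : HoloOnH f) :
    DifferentiableOn ℂ (extH f) CPos := by
  obtain ⟨F, hF, h⟩ := hf
  exact hF.congr fun z hz => by rw [extH_of_mem f hz, ← h]

/-- The space of holomorphic functions on `ℂ₊`. -/
def HolH : Submodule ℂ (↥CPos → ℂ) where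
  carrier := {f | HoloOnH f}
  add_mem' := by
    rintro f g ⟨F, hF, h⟩ ⟨G, hG, h'⟩
    exact ⟨F + G, hF.add hG, fun z => by simp [h, h']⟩
  zero_mem' := ⟨0, differentiableOn_const 0, fun z => rfl⟩
  smul_mem' := by
    rintro c f ⟨F, hF, h⟩
    exact ⟨c • F, hF.const_smul c, fun z => by simp [h]⟩

/-- Evaluation of a holomorphic function. -/
instance : CoeFun ↥HolH (fun _ => ↥CPos → ℂ) := ⟨fun f => f.1⟩

lemma differentiableOn_extH (f : ↥HolH) : DifferentiableOn ℂ (extH f) CPos :=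
  HoloOnH.differentiableOn f.2

/-- The affine map `z ↦ a z + b` of `ℂ₊`. -/
def affPt (a : ℝ) (ha : 0 < a) (b : ℂ) (hb : 0 ≤ b.im) (z : ↥CPos) : ↥CPos :=
  ⟨(a : ℂ) * z + b, by
    have hz : 0 < (z : ℂ).im := z.2
    have := mul_pos ha hz
    show 0 < ((a : ℂ) * z + b).im
    simp
    linarith⟩

/-- Composition with the affine map `z ↦ a z + b`. -/
def affH (a : ℝ) (ha : 0 < a) (b : ℂ) (hb : 0 ≤ b.im) : ↥HolH →ₗ[ℂ] ↥HolH where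
  toFun f := ⟨fun z => f (affPt a ha b hb z), by
    refine ⟨fun z => extH f ((a : ℂ) * z + b), ?_, fun z => ?_⟩
    · refine (differentiableOn_extH f).comp (by fun_prop) fun z hz => (affPt a ha b hb ⟨z, hz⟩).2
    · exact extH_coe f (affPt a ha b hb z)⟩
  map_add' f g := rfl
  map_smul' c f := rfl

lemma affH_apply (a : ℝ) (ha : 0 < a) (b : ℂ) (hb : 0 ≤ b.im) (f : ↥HolH) (z : ↥CPos) :
    affH a ha b hb f z = f (affPt a ha b hb z) := rfl

lemma differentiableAt_extH (f : ↥HolH) (z : ↥CPos) : DifferentiableAt ℂ (extH f) z :=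
  (differentiableOn_extH f).differentiableAt (isOpen_CPos.mem_nhds z.2)

/-- Complex differentiation on `Hol(ℂ₊)`. -/
def derH : ↥HolH →ₗ[ℂ] ↥HolH where
  toFun f := ⟨pdH f, deriv (extH f), (differentiableOn_extH f).deriv isOpen_CPos, fun z => rfl⟩
  map_add' f g := by
    ext z
    show deriv (extH (f.1 + g.1)) z = deriv (extH f) z + deriv (extH g) z
    rw [← deriv_add (differentiableAt_extH f z) (differentiableAt_extH g z)]
    congr 1
    ext y
    by_cases hy : y ∈ CPos <;> simp [extH, hy]
  map_smul' c f := by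
    ext z
    show deriv (extH (c • f.1)) z = c * deriv (extH f) z
    rw [← deriv_const_mul _ (differentiableAt_extH f z)]
    congr 1
    ext y
    by_cases hy : y ∈ CPos <;> simp [extH, hy]

lemma derH_pow_coe (f : ↥HolH) (n : ℕ) : (((derH ^ n) f : ↥HolH) : ↥CPos → ℂ) = pdH^[n] f := by
  induction n with
  | zero => rfl
  | succ n ih =>
    rw [pow_succ', Function.iterate_succ_apply', ← ih]
    rfl

lemma hasDerivAt_extH (f : ↥HolH) (z : ↥CPos) : HasDerivAt (extH f) (derH f z) z :=
  (differentiableAt_extH f z).hasDerivAt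

lemma iteratedDeriv_extH (f : ↥HolH) (n : ℕ) (z : ↥CPos) :
    iteratedDeriv n (extH f) z = (derH ^ n) f z := by
  induction n generalizing f with
  | zero => simp [extH_coe]
  | succ n ih =>
    rw [iteratedDeriv_succ', pow_succ, Module.End.mul_apply, ← ih]
    apply Filter.EventuallyEq.iteratedDeriv_eq
    filter_upwards [isOpen_CPos.mem_nhds z.2] with y hy
    exact (extH_coe (derH f) ⟨y, hy⟩).symm

lemma mem_CPos_of_closedBall {c z : ℂ} {r : ℝ} (hr : r < c.im) (hz : z ∈ Metric.closedBall c r) :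
    z ∈ CPos := by
  have h1 := (Complex.abs_im_le_norm (z - c)).trans (mem_closedBall_iff_norm.1 hz)
  have h2 := (abs_le.1 h1).1
  simp at h2
  show 0 < z.im
  linarith

lemma exists_bound_of_holH (f : ↥HolH) {c : ℂ} {r : ℝ} (hr : r < c.im) :
    ∃ B, 0 ≤ B ∧ ∀ z : ↥CPos, (z : ℂ) ∈ Metric.closedBall c r → ‖f z‖ ≤ B := by
  have hc : ContinuousOn (extH f) (Metric.closedBall c r) :=
    (differentiableOn_extH f).continuousOn.mono fun z hz => mem_CPos_of_closedBall hr hz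
  obtain ⟨B, hB⟩ := (isCompact_closedBall c r).exists_bound_of_continuousOn hc
  refine ⟨max B 0, le_max_right _ _, fun z hz => ?_⟩
  rw [← extH_coe f.1 z]
  exact (hB z hz).trans (le_max_left _ _)

lemma norm_derH_pow_le (f : ↥HolH) (z : ↥CPos) {ρ B : ℝ} (hρ : 0 < ρ) (hρz : ρ < (z : ℂ).im)
    (hB : ∀ y : ↥CPos, (y : ℂ) ∈ Metric.closedBall (z : ℂ) ρ → ‖f y‖ ≤ B) (n : ℕ) :
    ‖(derH ^ n) f z‖ ≤ n.factorial * B / ρ ^ n := by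
  rw [← iteratedDeriv_extH]
  apply Complex.norm_iteratedDeriv_le_of_forall_mem_sphere_norm_le n hρ
  · apply DifferentiableOn.diffContOnCl
    refine (differentiableOn_extH f).mono fun y hy => mem_CPos_of_closedBall hρz ?_
    exact Metric.closure_ball_subset_closedBall hy
  · intro y hy
    have hy' := mem_CPos_of_closedBall hρz (Metric.sphere_subset_closedBall hy)
    rw [extH_of_mem _ hy']
    exact hB ⟨y, hy'⟩ (Metric.sphere_subset_closedBall hy)

lemma taylor_bound (f : ↥HolH) {z z' : ↥CPos} {w : ℂ} (hz' : (z' : ℂ) = z + w) {ρ θ B : ℝ}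
    (hρ : 0 < ρ) (hρz : ρ < (z : ℂ).im) (hθ1 : θ < 1) (hw : ‖w‖ ≤ ρ * θ)
    (hB : ∀ y : ↥CPos, (y : ℂ) ∈ Metric.closedBall (z : ℂ) ρ → ‖f y‖ ≤ B) (n : ℕ) :
    ‖f z' - ∑ j ∈ Finset.range n, w ^ j / j.factorial * (derH ^ j) f z‖
      ≤ B * θ ^ n / (1 - θ) := by
  have hθ : 0 ≤ θ := by
    have := (norm_nonneg w).trans hw
    exact nonneg_of_mul_nonneg_right this hρ
  have hwρ : ‖w‖ < ρ := by nlinarith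
  have hs : HasSum (fun j => w ^ j / j.factorial * (derH ^ j) f z) (f z') := by
    have h := Complex.hasSum_taylorSeries_on_ball (f := extH f) (c := (z : ℂ)) (r := ρ)
      ((differentiableOn_extH f).mono fun y hy =>
        mem_CPos_of_closedBall hρz (Metric.ball_subset_closedBall hy)) (z := (z' : ℂ))
      (by rw [hz', mem_ball_iff_norm]; simpa using hwρ)
    rw [extH_coe] at h
    have he : (fun j => w ^ j / j.factorial * (derH ^ j) f z) = fun j : ℕ =>
        ((j.factorial : ℂ))⁻¹ • ((z' : ℂ) - z) ^ j • iteratedDeriv j (extH f) z := by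
      ext j
      rw [iteratedDeriv_extH, hz']
      simp only [add_sub_cancel_left, smul_eq_mul]
      ring
    rw [he]
    exact h
  rw [norm_sub_rev]
  refine norm_sub_le_of_geometric_bound_of_hasSum hθ1 (fun j => ?_) hs n
  have hB0 : 0 ≤ B := (norm_nonneg _).trans (hB z (Metric.mem_closedBall_self hρ.le))
  have h1 := norm_derH_pow_le f z hρ hρz hB j
  rw [norm_mul, norm_div, norm_pow, Complex.norm_natCast]
  have hj : (0 : ℝ) < j.factorial := by positivity
  calc ‖w‖ ^ j / j.factorial * ‖(derH ^ j) f z‖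
      ≤ (ρ * θ) ^ j / j.factorial * (j.factorial * B / ρ ^ j) := by gcongr
    _ = B * θ ^ j := by
      rw [mul_pow]; field_simp

/-- A linear functional on `Hol(ℂ₊)` controlled by the values on the closed disc of centre `c` and
radius `r`. -/
def LocBdd (L : ↥HolH →ₗ[ℂ] ℂ) (c : ℂ) (r : ℝ) : Prop :=
  ∃ C, 0 ≤ C ∧ ∀ (f : ↥HolH) (B : ℝ),
    (∀ z : ↥CPos, (z : ℂ) ∈ Metric.closedBall c r → ‖f z‖ ≤ B) → ‖L f‖ ≤ C * B

lemma LocBdd.comp_affH {L : ↥HolH →ₗ[ℂ] ℂ} {c : ℂ} {r : ℝ} (hL : LocBdd L c r)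
    (a : ℝ) (ha : 0 < a) (b : ℂ) (hb : 0 ≤ b.im) :
    LocBdd (L ∘ₗ affH a ha b hb) (a * c + b) (a * r) := by
  obtain ⟨C, hC, h⟩ := hL
  refine ⟨C, hC, fun f B hB => h _ B fun z hz => hB _ ?_⟩
  rw [mem_closedBall_iff_norm] at hz ⊢
  have : ((affPt a ha b hb z : ↥CPos) : ℂ) - (a * c + b) = a * (z - c) := by
    simp only [affPt]; ring
  rw [this, norm_mul, Complex.norm_real, Real.norm_of_nonneg ha.le]
  gcongr

lemma LocBdd.comp_derH {L : ↥HolH →ₗ[ℂ] ℂ} {c : ℂ} {r r' : ℝ} (hL : LocBdd L c r)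
    (hr : r < r') (hr' : r' < c.im) : LocBdd (L ∘ₗ derH) c r' := by
  obtain ⟨C, hC, h⟩ := hL
  have hd : 0 < r' - r := sub_pos.2 hr
  refine ⟨C / (r' - r), by positivity, fun f B hB => ?_⟩
  have := h (derH f) (B / (r' - r)) fun z hz => by
    have hsub : Metric.closedBall (z : ℂ) (r' - r) ⊆ Metric.closedBall c r' := by
      apply Metric.closedBall_subset_closedBall'
      have := Metric.mem_closedBall.1 hz
      linarith
    have him : r' - r < (z : ℂ).im := by
      have h1 := (Complex.abs_im_le_norm (z - c)).trans (mem_closedBall_iff_norm.1 hz)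
      have h2 := (abs_le.1 h1).1
      simp at h2
      linarith
    have h3 := norm_derH_pow_le f z hd him (fun y hy => hB y (hsub hy)) 1
    simpa using h3
  calc ‖(L ∘ₗ derH) f‖ ≤ C * (B / (r' - r)) := this
    _ = C / (r' - r) * B := by ring

lemma tendsto_of_uniform {L : ↥HolH →ₗ[ℂ] ℂ} {c : ℂ} {r : ℝ} (hL : LocBdd L c r)
    {f : ↥HolH} {u : ℕ → ↥HolH} {b : ℕ → ℝ} (hb : Filter.Tendsto b Filter.atTop (nhds 0))
    (h : ∀ᶠ n in Filter.atTop,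
      ∀ z : ↥CPos, (z : ℂ) ∈ Metric.closedBall c r → ‖u n z - f z‖ ≤ b n) :
    Filter.Tendsto (fun n => L (u n)) Filter.atTop (nhds (L f)) := by
  obtain ⟨C, hC, hLC⟩ := hL
  rw [tendsto_iff_norm_sub_tendsto_zero]
  refine squeeze_zero' (Filter.Eventually.of_forall fun n => norm_nonneg _) ?_
    (g := fun n => C * b n) (by simpa using hb.const_mul C)
  filter_upwards [h] with n hn
  rw [← map_sub]
  exact hLC _ _ fun z hz => hn z hz

/-- The monomial `z ^ n`. -/
def monH (n : ℕ) : ↥HolH :=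
  ⟨fun z => (z : ℂ) ^ n, fun z => z ^ n, by fun_prop, fun _ => rfl⟩

/-- The power `(z - c) ^ n`. -/
def powH (c : ℂ) (n : ℕ) : ↥HolH :=
  ⟨fun z => ((z : ℂ) - c) ^ n, fun z => (z - c) ^ n, by fun_prop, fun _ => rfl⟩

lemma coe_sum_holH {ι : Type*} (s : Finset ι) (F : ι → ↥HolH) (z : ↥CPos) :
    (∑ i ∈ s, F i : ↥HolH) z = ∑ i ∈ s, F i z := by
  rw [Submodule.coe_sum, Finset.sum_apply]

lemma map_powH_eq_zero (L : ↥HolH →ₗ[ℂ] ℂ) (c : ℂ) {n : ℕ} (h : ∀ j ≤ n, L (monH j) = 0) :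
    L (powH c n) = 0 := by
  have : powH c n = ∑ j ∈ Finset.range (n + 1),
      ((-c) ^ (n - j) * (n.choose j : ℂ)) • monH j := by
    ext z
    rw [coe_sum_holH]
    simp only [powH, monH, sub_eq_add_neg, add_pow, Submodule.coe_smul, Pi.smul_apply, smul_eq_mul]
    refine Finset.sum_congr rfl fun j _ => by ring
  rw [this, map_sum]
  refine Finset.sum_eq_zero fun j hj => ?_
  rw [map_smul, h j (by simpa [Nat.lt_succ_iff] using hj), smul_zero]

lemma tendsto_taylor {L : ↥HolH →ₗ[ℂ] ℂ} {c : ℂ} {r : ℝ} (hr0 : 0 < r) (hr : r < c.im)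
    (hL : LocBdd L c r) (f : ↥HolH) (hc : c ∈ CPos) :
    Filter.Tendsto (fun n => ∑ j ∈ Finset.range n,
      ((j.factorial : ℂ)⁻¹ * (derH ^ j) f ⟨c, hc⟩) * L (powH c j)) Filter.atTop (nhds (L f)) := by
  obtain ⟨ρ, hrρ, hρ⟩ := exists_between hr
  have hρ0 : 0 < ρ := hr0.trans hrρ
  obtain ⟨B, hB0, hB⟩ := exists_bound_of_holH f hρ
  have hθ : r / ρ < 1 := (div_lt_one hρ0).2 hrρ
  have key := tendsto_of_uniform hL (f := f)
    (u := fun n => ∑ j ∈ Finset.range n, ((j.factorial : ℂ)⁻¹ * (derH ^ j) f ⟨c, hc⟩) • powH c j)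
    (b := fun n => B * (r / ρ) ^ n / (1 - r / ρ)) ?_ ?_
  · simpa only [map_sum, map_smul, smul_eq_mul] using key
  · have := ((tendsto_pow_atTop_nhds_zero_of_lt_one (by positivity) hθ).const_mul B).div_const
      (1 - r / ρ)
    simpa using this
  · refine Filter.Eventually.of_forall fun n z hz => ?_
    rw [norm_sub_rev]
    have := taylor_bound f (z := ⟨c, hc⟩) (z' := z) (w := z - c) (by simp) hρ0 hρ hθ
      (by rw [mul_div_cancel₀ _ hρ0.ne']; exact mem_closedBall_iff_norm.1 hz) hB n
    refine le_of_eq_of_le (congrArg _ ?_) this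
    show f z - (∑ j ∈ Finset.range n, _ : ↥HolH) z = _
    rw [coe_sum_holH]
    refine congrArg _ (Finset.sum_congr rfl fun j _ => ?_)
    simp only [powH, Submodule.coe_smul, Pi.smul_apply, smul_eq_mul]
    ring

lemma map_eq_zero_of_vanish {L : ↥HolH →ₗ[ℂ] ℂ} {c : ℂ} {r : ℝ} (hr0 : 0 < r) (hr : r < c.im)
    (hL : LocBdd L c r) (f : ↥HolH) (hc : c ∈ CPos)
    (h : ∀ n, (derH ^ n) f ⟨c, hc⟩ = 0 ∨ ∀ j ≤ n, L (monH j) = 0) : L f = 0 := by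
  refine tendsto_nhds_unique (tendsto_taylor hr0 hr hL f hc)
    (tendsto_const_nhds.congr fun n => Eq.symm ?_)
  refine Finset.sum_eq_zero fun j _ => ?_
  rcases h j with h | h
  · rw [h]; simp
  · rw [map_powH_eq_zero L c h]; simp

lemma im_sub_le {c : ℂ} {r : ℝ} {z : ℂ} (hz : z ∈ Metric.closedBall c r) : c.im - r ≤ z.im := by
  have h1 := (Complex.abs_im_le_norm (z - c)).trans (mem_closedBall_iff_norm.1 hz)
  have h2 := (abs_le.1 h1).1
  simp at h2
  linarith

section Functionals

variable {X : Type*} [SeminormedAddCommGroup X] [NormedSpace ℂ X]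

/-- Boundedness of a linear functional for the seminorm of the domain. -/
def BddFun (Λ : X →ₗ[ℂ] ℂ) : Prop := ∃ C, ∀ f, ‖Λ f‖ ≤ C * ‖f‖

lemma BddFun.of_tendsto [CompleteSpace X] {Λ : ℕ → X →ₗ[ℂ] ℂ} {Λ' : X →ₗ[ℂ] ℂ}
    (h : ∀ n, BddFun (Λ n))
    (hlim : ∀ f, Filter.Tendsto (fun n => Λ n f) Filter.atTop (nhds (Λ' f))) : BddFun Λ' := by
  choose C hC using h
  obtain ⟨C', hC'⟩ := banach_steinhaus (g := fun n => (Λ n).mkContinuous (C n) (hC n)) fun f => by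
    obtain ⟨B, hB⟩ := (hlim f).norm.bddAbove_range
    exact ⟨B, fun n => hB ⟨n, rfl⟩⟩
  refine ⟨C', fun f => le_of_tendsto (hlim f).norm (Filter.Eventually.of_forall fun n => ?_)⟩
  exact ((Λ n).mkContinuous (C n) (hC n)).le_of_opNorm_le (hC' n) f

lemma BddFun.add {Λ Λ' : X →ₗ[ℂ] ℂ} (h : BddFun Λ) (h' : BddFun Λ') : BddFun (Λ + Λ') := by
  obtain ⟨C, hC⟩ := h
  obtain ⟨C', hC'⟩ := h'
  refine ⟨C + C', fun f => (norm_add_le _ _).trans ?_⟩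
  rw [add_mul]
  exact add_le_add (hC f) (hC' f)

lemma BddFun.smul {Λ : X →ₗ[ℂ] ℂ} (h : BddFun Λ) (a : ℂ) : BddFun (a • Λ) := by
  obtain ⟨C, hC⟩ := h
  refine ⟨‖a‖ * C, fun f => ?_⟩
  rw [LinearMap.smul_apply, norm_smul, mul_assoc]
  gcongr
  exact hC f

lemma BddFun.zero : BddFun (0 : X →ₗ[ℂ] ℂ) := ⟨0, by simp⟩

lemma BddFun.sum {ι : Type*} (s : Finset ι) {Λ : ι → X →ₗ[ℂ] ℂ} (h : ∀ i, BddFun (Λ i)) :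
    BddFun (∑ i ∈ s, Λ i) :=
  Finset.sum_induction Λ BddFun (fun _ _ => BddFun.add) BddFun.zero fun i _ => h i

/-- The operator `T` on `Hol(ℂ₊)` lifts to a bounded operation on `X` through `J`. -/
def Lifts (J : X →ₗ[ℂ] ↥HolH) (T : ↥HolH →ₗ[ℂ] ↥HolH) : Prop :=
  ∃ C, 0 ≤ C ∧ ∀ f, ∃ f', J f' = T (J f) ∧ ‖f'‖ ≤ C * ‖f‖

lemma BddFun.comp_of_lifts {J : X →ₗ[ℂ] ↥HolH} {T : ↥HolH →ₗ[ℂ] ↥HolH} (hT : Lifts J T)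
    {L : ↥HolH →ₗ[ℂ] ℂ} (hL : BddFun (L ∘ₗ J)) : BddFun ((L ∘ₗ T) ∘ₗ J) := by
  obtain ⟨C, hC, h⟩ := hT
  obtain ⟨C', hC'⟩ := hL
  refine ⟨|C'| * C, fun f => ?_⟩
  obtain ⟨f', h1, h2⟩ := h f
  have := hC' f'
  simp only [LinearMap.comp_apply] at this ⊢
  rw [← h1]
  calc ‖L (J f')‖ ≤ C' * ‖f'‖ := this
    _ ≤ |C'| * (C * ‖f‖) := by gcongr; exact le_abs_self C'
    _ = |C'| * C * ‖f‖ := by ring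

end Functionals

section Bounded

variable {X : Type*} [SeminormedAddCommGroup X] [NormedSpace ℂ X]

/-- The continuous linear functionals on `Hol(ℂ₊)` which are bounded on `X`. -/
structure BddLoc (J : X →ₗ[ℂ] ↥HolH) (L : ↥HolH →ₗ[ℂ] ℂ) : Prop where
  loc : ∃ c r, 0 < r ∧ r < c.im ∧ LocBdd L c r
  bdd : BddFun (L ∘ₗ J)

lemma tendsto_inv_nat_succ :
    Filter.Tendsto (fun n : ℕ => ((n : ℝ) + 1)⁻¹) Filter.atTop (nhds 0) := by
  simpa [one_div] using tendsto_one_div_add_atTop_nhds_zero_nat (𝕜 := ℝ)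

lemma tendsto_quotient_bound (A M : ℝ) :
    Filter.Tendsto (fun n : ℕ => A * ((n : ℝ) + 1)⁻¹ / (1 - M * ((n : ℝ) + 1)⁻¹))
      Filter.atTop (nhds 0) := by
  have h := tendsto_inv_nat_succ
  have h2 := (h.const_mul A).div ((h.const_mul M).const_sub 1) (by simp)
  simp only [mul_zero, sub_zero, zero_div] at h2
  exact h2

lemma tendsto_difference_quotient {L : ↥HolH →ₗ[ℂ] ℂ} {c : ℂ} {r : ℝ} (hr : r < c.im)
    (hL : LocBdd L c r) (f : ↥HolH) :
    Filter.Tendsto (fun n : ℕ => ((n : ℂ) + 1) *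
      (L (affH 1 one_pos (((n : ℝ) + 1)⁻¹ : ℝ) (by simp) f) - L f))
      Filter.atTop (nhds (L (derH f))) := by
  set ρ := (c.im - r) / 2 with hρdef
  have hρ : 0 < ρ := by rw [hρdef]; linarith
  obtain ⟨B, hB0, hB⟩ := exists_bound_of_holH f (c := c) (r := r + ρ) (by rw [hρdef]; linarith)
  have key := tendsto_of_uniform hL (f := derH f)
    (u := fun n : ℕ => ((n : ℂ) + 1) • (affH 1 one_pos (((n : ℝ) + 1)⁻¹ : ℝ) (by simp) f - f))
    (tendsto_quotient_bound (B / ρ ^ 2) (1 / ρ)) ?_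
  · simpa only [map_smul, map_sub, smul_eq_mul] using key
  have hev : ∀ᶠ n : ℕ in Filter.atTop, ((n : ℝ) + 1)⁻¹ < ρ :=
    tendsto_inv_nat_succ.eventually_lt_const hρ
  filter_upwards [hev] with n hn z hz
  set t : ℝ := ((n : ℝ) + 1)⁻¹ with ht
  have ht0 : 0 < t := by positivity
  have h1 : c.im - r ≤ (z : ℂ).im := im_sub_le hz
  have h2 := taylor_bound f (z := z) (z' := affPt 1 one_pos (t : ℝ) (by simp) z) (w := (t : ℂ))
    (by simp [affPt]) (ρ := ρ) (θ := t / ρ) (B := B) hρ (by rw [hρdef]; linarith)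
    ((div_lt_one hρ).2 hn)
    (by rw [mul_div_cancel₀ _ hρ.ne', Complex.norm_real, Real.norm_of_nonneg ht0.le])
    (fun y hy => hB y (Metric.closedBall_subset_closedBall'
      (by have := Metric.mem_closedBall.1 hz; linarith) hy)) 2
  have hnt : ((n : ℂ) + 1) = (t : ℂ)⁻¹ := by rw [ht]; push_cast; rw [inv_inv]
  have htc : (t : ℂ) ≠ 0 := by exact_mod_cast ht0.ne'
  have h3 : ((((n : ℂ) + 1) • (affH 1 one_pos (t : ℝ) (by simp) f - f) : ↥HolH) : ↥CPos → ℂ) z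
      - derH f z = (t : ℂ)⁻¹ * (f (affPt 1 one_pos (t : ℝ) (by simp) z) -
        ∑ j ∈ Finset.range 2, (t : ℂ) ^ j / j.factorial * (derH ^ j) f z) := by
    simp only [Submodule.coe_smul, Submodule.coe_sub, Pi.smul_apply, Pi.sub_apply, smul_eq_mul,
      hnt, affH_apply, Finset.sum_range_succ, Finset.sum_range_zero, pow_zero, pow_one,
      Module.End.one_apply, Nat.factorial]
    field_simp
    push_cast
    ring
  rw [h3, norm_mul, norm_inv, Complex.norm_real, Real.norm_of_nonneg ht0.le]
  calc t⁻¹ * _ ≤ t⁻¹ * (B * (t / ρ) ^ 2 / (1 - t / ρ)) := by gcongr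
    _ = B / ρ ^ 2 * t / (1 - 1 / ρ * t) := by
      rw [div_pow, one_div_mul_eq_div]
      field_simp

variable [CompleteSpace X]

lemma BddLoc.comp_derH {J : X →ₗ[ℂ] ↥HolH} {L : ↥HolH →ₗ[ℂ] ℂ} (hL : BddLoc J L)
    (hT : ∀ x : ℝ, Lifts J (affH 1 one_pos x (by simp))) : BddLoc J (L ∘ₗ derH) := by
  obtain ⟨c, r, hr0, hr, hloc⟩ := hL.loc
  obtain ⟨r', hrr', hr'⟩ := exists_between hr
  refine ⟨⟨c, r', hr0.trans hrr', hr', hloc.comp_derH hrr' hr'⟩, ?_⟩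
  refine BddFun.of_tendsto (Λ := fun n : ℕ => ((n : ℂ) + 1) •
    ((L ∘ₗ affH 1 one_pos (((n : ℝ) + 1)⁻¹ : ℝ) (by simp)) ∘ₗ J + (-1 : ℂ) • (L ∘ₗ J)))
    (fun n => ?_) fun f => ?_
  · exact ((hL.bdd.comp_of_lifts (hT _)).add (hL.bdd.smul _)).smul _
  · have := tendsto_difference_quotient hr hloc (J f)
    simpa [sub_eq_add_neg, mul_add] using this

lemma BddLoc.comp_derH_pow {J : X →ₗ[ℂ] ↥HolH} {L : ↥HolH →ₗ[ℂ] ℂ} (hL : BddLoc J L)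
    (hT : ∀ x : ℝ, Lifts J (affH 1 one_pos x (by simp))) (n : ℕ) :
    BddLoc J (L ∘ₗ derH ^ n) := by
  induction n with
  | zero => simpa [Module.End.one_eq_id] using hL
  | succ n ih =>
    have := ih.comp_derH hT
    rwa [LinearMap.comp_assoc, ← Module.End.mul_eq_comp, ← pow_succ] at this

lemma BddFun.comp_shift_small {J : X →ₗ[ℂ] ↥HolH} {L : ↥HolH →ₗ[ℂ] ℂ} (hb : BddFun (L ∘ₗ J))
    {c : ℂ} {r : ℝ} (hr0 : 0 < r) (hloc : LocBdd L c r)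
    (hT : ∀ x : ℝ, Lifts J (affH 1 one_pos x (by simp))) {y : ℝ} (hy : 0 ≤ y)
    (hyr : y < c.im - r) :
    BddFun ((L ∘ₗ affH 1 one_pos (y * Complex.I) (by simpa using hy)) ∘ₗ J) := by
  have hL : BddLoc J L := ⟨⟨c, r, hr0, by linarith, hloc⟩, hb⟩
  refine BddFun.of_tendsto (Λ := fun n : ℕ => ∑ j ∈ Finset.range n,
    (((y * Complex.I) ^ j / j.factorial : ℂ)) • ((L ∘ₗ derH ^ j) ∘ₗ J))
    (fun n => BddFun.sum _ fun j => (hL.comp_derH_pow hT j).bdd.smul _) fun f => ?_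
  obtain ⟨ρ, hyρ, hρr⟩ := exists_between hyr
  have hρ : 0 < ρ := hy.trans_lt hyρ
  have hθ : y / ρ < 1 := (div_lt_one hρ).2 hyρ
  obtain ⟨B, hB0, hB⟩ := exists_bound_of_holH (J f) (c := c) (r := r + ρ) (by linarith)
  have key := tendsto_of_uniform hloc (f := affH 1 one_pos (y * Complex.I) (by simpa using hy) (J f))
    (u := fun n => ∑ j ∈ Finset.range n,
      (((y * Complex.I) ^ j / j.factorial : ℂ)) • (derH ^ j) (J f))
    (b := fun n => B * (y / ρ) ^ n / (1 - y / ρ)) ?_ ?_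
  · simpa only [map_sum, map_smul, smul_eq_mul, LinearMap.sum_apply, LinearMap.smul_apply,
      LinearMap.comp_apply] using key
  · have := ((tendsto_pow_atTop_nhds_zero_of_lt_one (by positivity) hθ).const_mul B).div_const
      (1 - y / ρ)
    simpa using this
  · refine Filter.Eventually.of_forall fun n z hz => ?_
    have h1 : c.im - r ≤ (z : ℂ).im := im_sub_le hz
    rw [norm_sub_rev]
    have := taylor_bound (J f) (z := z)
      (z' := affPt 1 one_pos (y * Complex.I) (by simpa using hy) z) (w := y * Complex.I)
      (by simp [affPt]) (ρ := ρ) (θ := y / ρ) (B := B) hρ (by linarith) hθ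
      (by rw [mul_div_cancel₀ _ hρ.ne']; simp [abs_of_nonneg hy])
      (fun w hw => hB w (Metric.closedBall_subset_closedBall'
        (by have := Metric.mem_closedBall.1 hz; linarith) hw)) n
    refine le_of_eq_of_le (congrArg _ ?_) this
    show _ - (∑ j ∈ Finset.range n, _ : ↥HolH) z = _
    rw [coe_sum_holH]
    rfl

lemma affH_affH {a a' : ℝ} (ha : 0 < a) (ha' : 0 < a') {b b' : ℂ} (hb : 0 ≤ b.im)
    (hb' : 0 ≤ b'.im) (f : ↥HolH) {a'' : ℝ} (ha'' : 0 < a'') {b'' : ℂ} (hb'' : 0 ≤ b''.im)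
    (h : a'' = a' * a) (h' : b'' = a' * b + b') :
    affH a ha b hb (affH a' ha' b' hb' f) = affH a'' ha'' b'' hb'' f := by
  ext z
  refine congrArg f.1 (Subtype.ext ?_)
  simp only [affPt, h, h']
  push_cast
  ring

lemma BddFun.comp_shift {J : X →ₗ[ℂ] ↥HolH} {L : ↥HolH →ₗ[ℂ] ℂ} (hL : BddLoc J L)
    (hT : ∀ x : ℝ, Lifts J (affH 1 one_pos x (by simp))) {y : ℝ} (hy : 0 ≤ y) :
    BddFun ((L ∘ₗ affH 1 one_pos (y * Complex.I) (by simpa using hy)) ∘ₗ J) := by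
  obtain ⟨c, r, hr0, hr, hloc⟩ := hL.loc
  obtain ⟨N, hN⟩ := exists_nat_gt (y / (c.im - r))
  have hd : 0 < c.im - r := sub_pos.2 hr
  have hN0 : (0 : ℝ) < N := (by positivity : 0 ≤ y / (c.im - r)).trans_lt hN
  have hstep : y / N < c.im - r := by
    rw [div_lt_iff₀ hN0]
    rw [div_lt_iff₀ hd] at hN
    linarith
  have main : ∀ n : ℕ, BddFun ((L ∘ₗ affH 1 one_pos ((n * (y / N) : ℝ) * Complex.I)
      (by simp; positivity)) ∘ₗ J) := by
    intro n
    induction n with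
    | zero =>
      have h0 : L ∘ₗ affH 1 one_pos (((0 : ℕ) * (y / N) : ℝ) * Complex.I) (by simp) = L := by
        refine LinearMap.ext fun f => congrArg L (Subtype.ext (funext fun z => ?_))
        refine congrArg f.1 (Subtype.ext ?_)
        simp [affPt]
      rw [h0]
      exact hL.bdd
    | succ n ih =>
      have hn : 0 ≤ n * (y / N) := by positivity
      have hlocn := hloc.comp_affH 1 one_pos ((n * (y / N) : ℝ) * Complex.I) (by simp; positivity)
      have := ih.comp_shift_small (by simpa using hr0) hlocn hT (y := y / N) (by positivity)
        (by simp at hn ⊢; linarith)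
      rw [LinearMap.comp_assoc _ _ L] at this
      convert this using 3
      refine (LinearMap.ext fun f => ?_).symm
      refine affH_affH _ _ _ _ f _ _ (one_mul (1 : ℝ)).symm ?_
      push_cast
      ring
  have hyN : y = N * (y / N) := by field_simp
  convert main N using 6

/-- Evaluation of holomorphic functions at a point. -/
def evalH (z : ↥CPos) : ↥HolH →ₗ[ℂ] ℂ where
  toFun f := f z
  map_add' _ _ := rfl
  map_smul' _ _ := rfl

/-- The point `i` of `ℂ₊`. -/
def ptI : ↥CPos := ⟨Complex.I, by simp [CPos]⟩

lemma tendsto_dilation {L : ↥HolH →ₗ[ℂ] ℂ} {c : ℂ} {r : ℝ} (hr : 0 < r)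
    (hL : LocBdd L c r) {k : ℕ} (hk : ∀ j < k, L (monH j) = 0) (f : ↥HolH) :
    Filter.Tendsto (fun n : ℕ => ((n : ℂ) + 1) ^ k *
      L (affH ((n : ℝ) + 1)⁻¹ (by positivity) Complex.I (by simp) f))
      Filter.atTop (nhds ((derH ^ k) f ptI / k.factorial * L (monH k))) := by
  obtain ⟨B, hB0, hB⟩ := exists_bound_of_holH f (c := ptI) (r := 1 / 2)
    (by simp [ptI]; norm_num)
  set M := ‖c‖ + r with hM
  have hM0 : 0 < M := by positivity
  have key := tendsto_of_uniform hL (f := ((derH ^ k) f ptI / k.factorial) • monH k)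
    (u := fun n : ℕ => ((n : ℂ) + 1) ^ k •
      (affH ((n : ℝ) + 1)⁻¹ (by positivity) Complex.I (by simp) f -
        ∑ j ∈ Finset.range k, ((((n : ℂ) + 1)⁻¹) ^ j / j.factorial * (derH ^ j) f ptI) • monH j))
    (tendsto_quotient_bound (B * (2 * M) ^ (k + 1)) (2 * M)) ?_
  · simp only [map_smul, map_sub, map_sum, smul_eq_mul] at key
    refine key.congr fun n => ?_
    rw [Finset.sum_eq_zero, sub_zero]
    intro j hj
    rw [hk j (Finset.mem_range.1 hj), mul_zero]
  have hev : ∀ᶠ n : ℕ in Filter.atTop, ((n : ℝ) + 1)⁻¹ < 1 / (2 * M) :=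
    tendsto_inv_nat_succ.eventually_lt_const (by positivity)
  filter_upwards [hev] with n hn z hz
  set t : ℝ := ((n : ℝ) + 1)⁻¹ with ht
  have ht0 : 0 < t := by positivity
  have hnt : ((n : ℂ) + 1) = (t : ℂ)⁻¹ := by rw [ht]; push_cast; rw [inv_inv]
  have htc : (t : ℂ) ≠ 0 := by exact_mod_cast ht0.ne'
  have hzM : ‖(z : ℂ)‖ ≤ M := by
    have h1 := mem_closedBall_iff_norm.1 hz
    have h2 := norm_le_norm_add_norm_sub' (z : ℂ) c
    rw [hM]
    linarith
  have h2 := taylor_bound f (z := ptI) (z' := affPt t ht0 Complex.I (by simp) z)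
    (w := (t : ℂ) * z) (by simp [affPt, ptI, add_comm]) (ρ := 1 / 2) (θ := 2 * M * t) (B := B)
    (by norm_num) (by simp [ptI]; norm_num) (by rwa [lt_div_iff₀' (by positivity)] at hn)
    (by
      rw [norm_mul, Complex.norm_real, Real.norm_of_nonneg ht0.le]
      nlinarith) hB (k + 1)
  have h3 : ((((n : ℂ) + 1) ^ k • (affH t ht0 Complex.I (by simp) f -
        ∑ j ∈ Finset.range k, ((((n : ℂ) + 1)⁻¹) ^ j / j.factorial * (derH ^ j) f ptI) • monH j)
        : ↥HolH) : ↥CPos → ℂ) z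
      - ((((derH ^ k) f ptI / k.factorial) • monH k : ↥HolH) : ↥CPos → ℂ) z =
      ((t : ℂ)⁻¹) ^ k * (f (affPt t ht0 Complex.I (by simp) z) -
        ∑ j ∈ Finset.range (k + 1), ((t : ℂ) * z) ^ j / j.factorial * (derH ^ j) f ptI) := by
    simp only [Submodule.coe_smul, Submodule.coe_sub, Pi.smul_apply, Pi.sub_apply, smul_eq_mul,
      hnt, Finset.sum_range_succ, coe_sum_holH, monH, inv_inv]
    have h4 : ∑ j ∈ Finset.range k, (t : ℂ) ^ j / j.factorial * (derH ^ j) f ptI * (z : ℂ) ^ j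
        = ∑ j ∈ Finset.range k, ((t : ℂ) * z) ^ j / j.factorial * (derH ^ j) f ptI :=
      Finset.sum_congr rfl fun j _ => by rw [mul_pow]; ring
    rw [h4, mul_pow]
    have h5 : ((t : ℂ)⁻¹) ^ k * (t : ℂ) ^ k = 1 := by rw [← mul_pow, inv_mul_cancel₀ htc, one_pow]
    have h6 := affH_apply t ht0 Complex.I (by simp) f z
    linear_combination ((z : ℂ) ^ k / k.factorial * (derH ^ k) f ptI) * h5 +
      ((t : ℂ)⁻¹) ^ k * h6
  rw [h3, norm_mul, norm_pow, norm_inv, Complex.norm_real, Real.norm_of_nonneg ht0.le]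
  calc (t⁻¹) ^ k * _ ≤ (t⁻¹) ^ k * (B * (2 * M * t) ^ (k + 1) / (1 - 2 * M * t)) := by gcongr
    _ = ((t⁻¹) ^ k * t ^ k) * (B * (2 * M) ^ (k + 1) * t / (1 - 2 * M * t)) := by
      rw [mul_pow (2 * M) t, pow_succ t]; ring
    _ = _ := by rw [← mul_pow, inv_mul_cancel₀ ht0.ne', one_pow, one_mul]

lemma exists_bddFun_derH_pow {J : X →ₗ[ℂ] ↥HolH}
    (hT : ∀ x : ℝ, Lifts J (affH 1 one_pos x (by simp)))
    (hD : ∀ (a : ℝ) (ha : 0 < a), Lifts J (affH a ha 0 (by simp)))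
    (hsep : ∀ f, ‖f‖ ≠ 0 → ∃ L, BddLoc J L ∧ L (J f) ≠ 0) (hne : ∃ f : X, ‖f‖ ≠ 0) :
    ∃ k : ℕ, (∀ f, (derH ^ k) (J f) = 0 → ‖f‖ = 0) ∧
      BddFun ((evalH ptI ∘ₗ derH ^ k) ∘ₗ J) := by
  have hex : ∃ k : ℕ, ∃ L, BddLoc J L ∧ L (monH k) ≠ 0 := by
    obtain ⟨f, hf⟩ := hne
    obtain ⟨L, hL, hLf⟩ := hsep f hf
    by_contra! hcon
    obtain ⟨c, r, hr0, hr, hloc⟩ := hL.loc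
    exact hLf (map_eq_zero_of_vanish hr0 hr hloc _ (hr0.trans hr) fun n =>
      Or.inr fun j _ => hcon j L hL)
  classical
  refine ⟨Nat.find hex, fun f hf => ?_, ?_⟩
  · by_contra hf0
    obtain ⟨L, hL, hLf⟩ := hsep f hf0
    obtain ⟨c, r, hr0, hr, hloc⟩ := hL.loc
    refine hLf (map_eq_zero_of_vanish hr0 hr hloc _ (hr0.trans hr) fun n => ?_)
    rcases le_or_gt (Nat.find hex) n with h | h
    · left
      obtain ⟨m, rfl⟩ := Nat.exists_eq_add_of_le' h
      rw [pow_add, Module.End.mul_apply, hf, map_zero]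
      rfl
    · right
      intro j hj
      have := Nat.find_min hex (hj.trans_lt h)
      by_contra hne0
      exact this ⟨L, hL, hne0⟩
  · obtain ⟨L, hL, hLk⟩ := Nat.find_spec hex
    obtain ⟨c, r, hr0, hr, hloc⟩ := hL.loc
    have hlow : ∀ j < Nat.find hex, L (monH j) = 0 := fun j hj => by
      by_contra hne0
      exact Nat.find_min hex hj ⟨L, hL, hne0⟩
    set k := Nat.find hex
    have hlim : BddFun ((L (monH k) / k.factorial) • ((evalH ptI ∘ₗ derH ^ k) ∘ₗ J)) := by
      refine BddFun.of_tendsto (Λ := fun n : ℕ => ((n : ℂ) + 1) ^ k •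
        ((L ∘ₗ affH ((n : ℝ) + 1)⁻¹ (by positivity) Complex.I (by simp)) ∘ₗ J)) (fun n => ?_)
        fun f => ?_
      · have h1 := BddFun.comp_shift hL hT (y := (n : ℝ) + 1) (by positivity)
        have h2 := (h1.comp_of_lifts (hD ((n : ℝ) + 1)⁻¹ (by positivity))).smul
          (((n : ℂ) + 1) ^ k)
        rw [LinearMap.comp_assoc _ _ L] at h2
        convert h2 using 4
        refine (LinearMap.ext fun f => ?_).symm
        refine affH_affH _ _ _ _ f _ _ (mul_one (((n : ℝ) + 1)⁻¹)).symm ?_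
        have : ((n : ℂ) + 1) ≠ 0 := Nat.cast_add_one_ne_zero n
        push_cast
        field_simp
        simp
      · have := tendsto_dilation hr0 hloc hlow (J f)
        have e : ((L (monH k) / k.factorial) • ((evalH ptI ∘ₗ derH ^ k) ∘ₗ J)) f =
            (derH ^ k) (J f) ptI / k.factorial * L (monH k) := by
          show L (monH k) / k.factorial * (derH ^ k) (J f) ptI = _
          ring
        rw [e]
        exact this
    have hk0 : L (monH k) / k.factorial ≠ 0 :=
      div_ne_zero hLk (by exact_mod_cast k.factorial_ne_zero)
    have := hlim.smul (L (monH k) / k.factorial)⁻¹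
    rwa [smul_smul, inv_mul_cancel₀ hk0, one_smul] at this

end Bounded

lemma exists_closedBall_of_isCompact {K : Set ↥CPos} (hK : IsCompact K) :
    ∃ c r, 0 < r ∧ r < c.im ∧ ∀ z ∈ K, (z : ℂ) ∈ Metric.closedBall c r := by
  rcases K.eq_empty_or_nonempty with rfl | hne
  · exact ⟨Complex.I, 1 / 2, by norm_num, by norm_num, by simp⟩
  obtain ⟨z₀, hz₀, hmin⟩ := hK.exists_isMinOn hne
    (f := fun z : ↥CPos => (z : ℂ).im) (by fun_prop)
  obtain ⟨M, hM⟩ := hK.exists_bound_of_continuousOn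
    (f := fun z : ↥CPos => (z : ℂ)) (by fun_prop)
  set η := (z₀ : ℂ).im with hη
  have hη0 : 0 < η := z₀.2
  have hpos : 0 ≤ M ^ 2 / η := by positivity
  refine ⟨((M ^ 2 / η + η : ℝ) : ℂ) * Complex.I, M ^ 2 / η + η / 2, by positivity,
    ?_, fun z hz => ?_⟩
  · have : (((M ^ 2 / η + η : ℝ) : ℂ) * Complex.I).im = M ^ 2 / η + η := by
      rw [Complex.im_ofReal_mul, Complex.I_im, mul_one]
    rw [this]
    linarith
  have h1 : η ≤ (z : ℂ).im := hmin hz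
  have h2 := hM z hz
  have h3 : ‖(z : ℂ)‖ ^ 2 ≤ M ^ 2 := by gcongr
  rw [mem_closedBall_iff_norm]
  apply le_of_sq_le_sq _ (by positivity)
  rw [← Complex.normSq_eq_norm_sq, Complex.normSq_apply] at *
  simp only [Complex.sub_re, Complex.sub_im, Complex.mul_re, Complex.mul_im, Complex.ofReal_re,
    Complex.ofReal_im, Complex.I_re, Complex.I_im]
  have h4 : M ^ 2 / η * η = M ^ 2 := by field_simp
  nlinarith

/-- Restriction of holomorphic functions to a set. -/
def resH (K : Set ↥CPos) : ↥HolH →ₗ[ℂ] C(K, ℂ) where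
  toFun f := ⟨fun z => f z, by
    have h : Continuous fun z : ↥CPos => extH f z :=
      continuousOn_iff_continuous_domRestrict.1 (differentiableOn_extH f).continuousOn
    simp only [extH_coe] at h
    exact h.comp continuous_subtype_val⟩
  map_add' _ _ := rfl
  map_smul' _ _ := rfl

lemma exists_bddLoc_map_ne_zero {X : Type*} [SeminormedAddCommGroup X] [NormedSpace ℂ X]
    {J : X →ₗ[ℂ] ↥HolH} (W : Submodule ℂ ↥HolH)
    (hclosed : ∀ f : ↥HolH, (∀ K : Set ↥CPos, IsCompact K → ∀ ε : ℝ, 0 < ε →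
      ∃ g ∈ W, ∀ z ∈ K, ‖f z - g z‖ ≤ ε) → f ∈ W)
    (hcont : ∀ K : Set ↥CPos, IsCompact K → ∃ C : ℝ, 0 < C ∧ ∀ f : X, ∀ ε : ℝ, 0 < ε →
      ∃ g ∈ W, ∀ z ∈ K, ‖J f z - g z‖ ≤ C * ‖f‖ + ε)
    {f : X} (hf : J f ∉ W) : ∃ L, BddLoc J L ∧ L (J f) ≠ 0 := by
  have h1 := mt (hclosed (J f)) hf
  push Not at h1
  obtain ⟨K, hK, ε, hε, hKε⟩ := h1
  obtain ⟨c, r, hr0, hr, hcr⟩ := exists_closedBall_of_isCompact hK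
  set D : Set ↥CPos := Subtype.val ⁻¹' Metric.closedBall c r with hD
  have hDc : IsCompact D := by
    rw [Subtype.isCompact_iff, hD, Subtype.image_preimage_coe, Set.inter_eq_right.2
      fun z hz => mem_CPos_of_closedBall hr hz]
    exact isCompact_closedBall c r
  have : CompactSpace D := isCompact_iff_compactSpace.1 hDc
  set S : Submodule ℂ C(D, ℂ) := W.map (resH D)
  have hnorm : ∀ (g : ↥HolH) (B : ℝ), 0 ≤ B → (∀ z ∈ D, ‖g z‖ ≤ B) → ‖resH D g‖ ≤ B :=
    fun g B hB h => (ContinuousMap.norm_le _ hB).2 fun z => h z z.2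
  have hquot : ∀ (f g : ↥HolH), g ∈ W → ‖S.mkQ (resH D f)‖ ≤ ‖resH D (f - g)‖ := by
    intro f g hg
    have : S.mkQ (resH D f) = S.mkQ (resH D (f - g)) := by
      rw [map_sub, map_sub, sub_eq_self.2]
      exact (Submodule.Quotient.mk_eq_zero _).2 (Submodule.mem_map_of_mem hg)
    rw [this]
    exact Submodule.Quotient.norm_mk_le _ _
  have hne : ‖S.mkQ (resH D (J f))‖ ≠ 0 := by
    intro h0
    obtain ⟨m, hm, hmε⟩ := Submodule.Quotient.norm_mk_lt (S.mkQ (resH D (J f))) hε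
    rw [h0, zero_add] at hmε
    obtain ⟨g, hg, hgm⟩ := (Submodule.Quotient.eq S).1 hm.symm
    obtain ⟨z, hz, hzε⟩ := hKε g hg
    have h2 := (m.norm_coe_le_norm ⟨z, hcr z hz⟩).trans_lt hmε
    have h3 : J f z - g z = m ⟨z, hcr z hz⟩ := by
      have := congrArg (fun q : C(D, ℂ) => q ⟨z, hcr z hz⟩) hgm
      change g z = J f z - m ⟨z, hcr z hz⟩ at this
      rw [this]
      ring
    rw [h3] at hzε
    exact lt_asymm h2 hzε
  obtain ⟨φ, hφ1, hφ⟩ := exists_dual_vector ℂ _ hne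
  refine ⟨φ.toLinearMap ∘ₗ S.mkQ ∘ₗ resH D, ⟨⟨c, r, hr0, hr, 1, zero_le_one, fun g B hB => ?_⟩, ?_⟩, ?_⟩
  · have hB0 : 0 ≤ B := (norm_nonneg _).trans
      (hB ⟨c, hr0.trans hr⟩ (Metric.mem_closedBall_self hr0.le))
    have h2 := φ.le_opNorm (S.mkQ (resH D g))
    rw [hφ1] at h2
    refine h2.trans ?_
    gcongr
    refine (Submodule.Quotient.norm_mk_le _ _).trans (hnorm _ _ hB0 fun z hz => hB z hz)
  · obtain ⟨C, hC0, hC⟩ := hcont D hDc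
    refine ⟨C, fun g => le_of_forall_pos_le_add fun δ hδ => ?_⟩
    obtain ⟨g', hg', hgg'⟩ := hC g δ hδ
    have h2 := φ.le_opNorm (S.mkQ (resH D (J g)))
    rw [hφ1, one_mul] at h2
    exact h2.trans ((hquot _ _ hg').trans (hnorm _ _ (by positivity) hgg'))
  · show φ (S.mkQ (resH D (J f))) ≠ 0
    rw [hφ]
    exact Complex.ofReal_ne_zero.2 hne

lemma derH_pow_affH (a : ℝ) (ha : 0 < a) (b : ℂ) (hb : 0 ≤ b.im) (f : ↥HolH) (n : ℕ) :
    (derH ^ n) (affH a ha b hb f) = (a : ℂ) ^ n • affH a ha b hb ((derH ^ n) f) := by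
  induction n with
  | zero => simp
  | succ n ih =>
    rw [pow_succ', Module.End.mul_apply, ih, map_smul, Module.End.mul_apply, pow_succ, mul_smul]
    congr 1
    generalize (derH ^ n) f = g
    ext z
    have h1 := hasDerivAt_extH g (affPt a ha b hb z)
    have h2 : HasDerivAt (fun w : ℂ => a * w + b) a z := by
      simpa using ((hasDerivAt_id (z : ℂ)).const_mul (a : ℂ)).add_const b
    have h3 := h1.comp_of_eq (z : ℂ) h2 rfl
    have h4 : HasDerivAt (extH (affH a ha b hb g)) (derH (affH a ha b hb g) z) z :=
      hasDerivAt_extH _ z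
    have h5 := h3.unique (h4.congr_of_eventuallyEq (by
      filter_upwards [isOpen_CPos.mem_nhds z.2] with w hw
      rw [extH_of_mem _ hw]
      exact extH_coe g.1 (affPt a ha b hb ⟨w, hw⟩)))
    show derH (affH a ha b hb g) z = a * derH g (affPt a ha b hb z)
    rw [← h5, mul_comm]

lemma exists_riesz {X : Type*} [SeminormedAddCommGroup X] [InnerProductSpace ℂ X]
    [CompleteSpace X] {Λ : X →ₗ[ℂ] ℂ} (hΛ : BddFun Λ) : ∃ h : X, ∀ f, Λ f = inner ℂ h f := by
  obtain ⟨C, hC⟩ := hΛ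
  let φ : X →L[ℂ] ℂ := Λ.mkContinuous C hC
  have hφ : ∀ x y, Inseparable x y → φ x = φ y := fun x y h => (h.map φ.continuous).eq
  let ψ : SeparationQuotient X →L[ℂ] ℂ := SeparationQuotient.liftCLM φ hφ
  obtain ⟨h, hh⟩ := SeparationQuotient.surjective_mk ((InnerProductSpace.toDual ℂ _).symm ψ)
  refine ⟨h, fun f => ?_⟩
  rw [← SeparationQuotient.inner_mk_mk, hh, InnerProductSpace.toDual_symm_apply]
  rfl

lemma exists_homogeneous_ode {G : ↥HolH} {s : ℝ}
    (hG : ∀ (x y : ℝ) (_ : 0 < y), extH G (x + y * Complex.I) =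
      (starRingEnd ℂ) ((y ^ (-s) : ℝ) * extH G ((Complex.I - x) / y))) (z : ↥CPos) :
    ((z : ℂ) + Complex.I) * derH G z = -s * G z := by
  set x := (z : ℂ).re
  set y := (z : ℂ).im
  have hy : 0 < y := z.2
  have hyc : (y : ℂ) ≠ 0 := by exact_mod_cast hy.ne'
  have hz : (z : ℂ) = x + y * Complex.I := (Complex.re_add_im _).symm
  set ξ : ↥CPos := affPt y⁻¹ (by positivity) ((-x / y : ℝ) : ℂ) (by simp) ptI with hξ
  have hξc : (ξ : ℂ) = (Complex.I - x) / y := by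
    simp only [hξ, affPt, ptI]
    push_cast
    field_simp
    ring
  have hu : HasDerivAt (fun t : ℝ => extH G (t + y * Complex.I)) (derH G z) x := by
    have h1 := hasDerivAt_extH G z
    have h2 : HasDerivAt (fun t : ℂ => t + y * Complex.I) 1 x := (hasDerivAt_id _).add_const _
    simpa using (h1.comp_of_eq _ h2 hz).comp_ofReal
  have hv : HasDerivAt (fun t : ℝ => extH G (x + t * Complex.I)) (derH G z * Complex.I) y := by
    have h1 := hasDerivAt_extH G z
    have h2 : HasDerivAt (fun t : ℂ => x + t * Complex.I) Complex.I y := by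
      simpa using ((hasDerivAt_id (y : ℂ)).mul_const Complex.I).const_add (x : ℂ)
    exact (h1.comp_of_eq _ h2 hz).comp_ofReal
  have hu' : HasDerivAt (fun t : ℝ => (starRingEnd ℂ)
      ((y ^ (-s) : ℝ) * extH G ((Complex.I - t) / y)))
      ((starRingEnd ℂ) ((y ^ (-s) : ℝ) * (derH G ξ * (-1 / y)))) x := by
    have h1 := hasDerivAt_extH G ξ
    have h2 : HasDerivAt (fun t : ℂ => (Complex.I - t) / y) (-1 / y) x :=
      ((hasDerivAt_id _).const_sub _).div_const _
    exact ((h1.comp_of_eq _ h2 hξc).comp_ofReal.const_mul _).star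
  have hv' : HasDerivAt (fun t : ℝ => (starRingEnd ℂ)
      ((t ^ (-s) : ℝ) * extH G ((Complex.I - x) / t)))
      ((starRingEnd ℂ) ((-s * y ^ (-s - 1) : ℝ) * extH G ((Complex.I - x) / y) +
        (y ^ (-s) : ℝ) * (derH G ξ * (-(Complex.I - x) / y ^ 2)))) y := by
    have h1 := hasDerivAt_extH G ξ
    have h2 : HasDerivAt (fun t : ℂ => (Complex.I - x) / t) (-(Complex.I - x) / y ^ 2) y := by
      have h := (hasDerivAt_const (y : ℂ) (Complex.I - x)).div (hasDerivAt_id (y : ℂ)) hyc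
      rw [zero_mul, mul_one, zero_sub] at h
      exact h
    have h3 := (Real.hasDerivAt_rpow_const (p := -s) (Or.inl hy.ne')).ofReal_comp
    exact (h3.mul (h1.comp_of_eq _ h2 hξc).comp_ofReal).star
  have e1 := hu.unique (hu'.congr_of_eventuallyEq (Filter.Eventually.of_forall fun t => hG t y hy))
  have e2 := hv.unique (hv'.congr_of_eventuallyEq (by
    filter_upwards [lt_mem_nhds hy] with t ht using hG x t ht))
  have e3 := hG x y hy
  rw [← hz, extH_coe] at e3
  rw [← hξc, extH_coe, Real.rpow_sub_one hy.ne'] at e2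
  rw [← hξc, extH_coe] at e3
  simp only [map_mul, map_add, map_div₀, map_neg, map_sub, map_pow, map_one, Complex.conj_ofReal,
    Complex.conj_I] at e1 e2 e3
  push_cast at e2
  rw [hz]
  field_simp at e1 e2
  refine mul_left_cancel₀ hyc ?_
  linear_combination e2 + (x + Complex.I) * e1 + y * s * e3

lemma eq_cpow_of_ode {G : ↥HolH} {s : ℝ}
    (hG : ∀ z : ↥CPos, ((z : ℂ) + Complex.I) * derH G z = -s * G z) (z : ↥CPos) :
    G z = G ptI * (((z : ℂ) + Complex.I) / (2 * Complex.I)) ^ (-(s : ℂ)) := by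
  have hslit : ∀ z ∈ CPos, (z + Complex.I) / (2 * Complex.I) ∈ Complex.slitPlane := by
    intro z hz
    left
    have hz : 0 < z.im := hz
    have : (z + Complex.I) / (2 * Complex.I) = ((z.im + 1) / 2 : ℝ) + (-z.re / 2 : ℝ) * Complex.I := by
      rw [div_eq_iff (by simp)]
      conv_lhs => rw [← Complex.re_add_im z]
      push_cast
      linear_combination z.re * Complex.I_sq
    rw [this]
    simp
    linarith
  have hd : ∀ z ∈ CPos, HasDerivAt (fun z => extH G z *
      ((z + Complex.I) / (2 * Complex.I)) ^ (s : ℂ)) 0 z := by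
    intro z hz
    have h1 := hasDerivAt_extH G ⟨z, hz⟩
    have h2 : HasDerivAt (fun z : ℂ => (z + Complex.I) / (2 * Complex.I)) (1 / (2 * Complex.I)) z :=
      ((hasDerivAt_id z).add_const _).div_const _
    have hs := hslit z hz
    have h0 := Complex.slitPlane_ne_zero hs
    have h3 := h1.mul (h2.cpow_const (c := (s : ℂ)) hs)
    refine h3.congr_deriv ?_
    rw [Complex.cpow_sub _ _ h0, Complex.cpow_one]
    have h4 := hG ⟨z, hz⟩
    rw [extH_of_mem _ hz]
    have h5 : z + Complex.I ≠ 0 := fun h => h0 (by rw [h, zero_div])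
    change (z + Complex.I) * _ = _ at h4
    generalize ((z + Complex.I) / (2 * Complex.I)) ^ (s : ℂ) = P
    field_simp
    linear_combination P * h4
  have hconv : Convex ℝ CPos := convex_halfSpace_im_gt 0
  have hc := isOpen_CPos.is_const_of_deriv_eq_zero hconv.isPreconnected
    (fun z hz => (hd z hz).differentiableAt.differentiableWithinAt)
    (fun z hz => (hd z hz).deriv) z.2 ptI.2
  have h0 := Complex.slitPlane_ne_zero (hslit z z.2)
  have hI : ((ptI : ℂ) + Complex.I) / (2 * Complex.I) = 1 := by
    simp only [ptI]
    rw [← two_mul, div_self (by simp)]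
  simp only [extH_coe, hI, Complex.one_cpow, mul_one] at hc
  rw [Complex.cpow_neg, ← hc, mul_assoc, mul_inv_cancel₀, mul_one]
  simp [Complex.cpow_eq_zero_iff, h0]

section Abstract

variable {X : Type*} [SeminormedAddCommGroup X] [InnerProductSpace ℂ X] {J : X →ₗ[ℂ] ↥HolH} {s : ℝ}

/-- The weighted affine action of exponent `s` acts isometrically on `X`. -/
def IsomAction (J : X →ₗ[ℂ] ↥HolH) (s : ℝ) : Prop :=
  ∀ (a : ℝ) (ha : 0 < a) (b : ℝ), ∃ A : X → X,
    (∀ f, J (A f) = ((a ^ (s / 2) : ℝ) : ℂ) • affH a ha b (by simp) (J f)) ∧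
    ∀ f g, inner ℂ (A f) (A g) = inner ℂ f g

lemma IsomAction.lifts (hA : IsomAction J s) (a : ℝ) (ha : 0 < a) (b : ℝ) :
    Lifts J (affH a ha b (by simp)) := by
  obtain ⟨A, hJA, hAA⟩ := hA a ha b
  have hpos : 0 < a ^ (s / 2) := Real.rpow_pos_of_pos ha _
  refine ⟨(a ^ (s / 2))⁻¹, by positivity,
    fun f => ⟨(((a ^ (s / 2))⁻¹ : ℝ) : ℂ) • A f, ?_, ?_⟩⟩
  · rw [map_smul, hJA, smul_smul, ← Complex.ofReal_mul, inv_mul_cancel₀ hpos.ne',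
      Complex.ofReal_one, one_smul]
  · rw [norm_smul, Complex.norm_real, Real.norm_of_nonneg (by positivity),
      @norm_eq_sqrt_re_inner ℂ, hAA, ← @norm_eq_sqrt_re_inner ℂ]

lemma IsomAction.exists_kernel (hA : IsomAction J s) (hJ : Function.Injective J) {k : ℕ} {h : X}
    (hh : ∀ f, (derH ^ k) (J f) ptI = inner ℂ h f) (x y : ℝ) (hy : 0 < y) :
    ∃ h' : X, (derH ^ k) (J h') = ((y ^ (-(s + 2 * k)) : ℝ) : ℂ) •
        affH y⁻¹ (inv_pos.2 hy) ((-x / y : ℝ) : ℂ) (by simp) ((derH ^ k) (J h)) ∧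
      (∀ f, (derH ^ k) (J f) (affPt y hy x (by simp) ptI) = inner ℂ h' f) ∧
      ‖h'‖ = y ^ (-(s / 2) - k) * ‖h‖ := by
  obtain ⟨A, hJA, hAA⟩ := hA y hy x
  obtain ⟨A', hJA', hAA'⟩ := hA y⁻¹ (inv_pos.2 hy) (-x / y)
  have hinv : A (A' h) = h := by
    apply hJ
    rw [hJA, hJA', map_smul, smul_smul,
      affH_affH _ _ _ _ _ one_pos (b'' := 0) (by simp) (inv_mul_cancel₀ hy.ne').symm,
      ← Complex.ofReal_mul, Real.inv_rpow hy.le, mul_inv_cancel₀ (by positivity),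
      Complex.ofReal_one, one_smul]
    · refine Subtype.ext (funext fun z => congrArg (J h).1 (Subtype.ext ?_))
      simp [affPt]
    · have : (y : ℂ) ≠ 0 := by exact_mod_cast hy.ne'
      push_cast
      field_simp
      ring
  have hpow : y ^ (-(s / 2) - k) * (y ^ (s / 2) * y ^ k) = 1 := by
    rw [← Real.rpow_natCast y k, ← Real.rpow_add hy, ← Real.rpow_add hy]
    simp
  have hpow' : y ^ (-(s / 2) - k) * (y⁻¹ ^ (s / 2) * y⁻¹ ^ k) = y ^ (-(s + 2 * k)) := by
    rw [Real.inv_rpow hy.le, inv_pow, ← Real.rpow_natCast y k, ← Real.rpow_neg hy.le,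
      ← Real.rpow_neg hy.le, ← Real.rpow_add hy, ← Real.rpow_add hy]
    congr 1
    ring
  refine ⟨((y ^ (-(s / 2) - k) : ℝ) : ℂ) • A' h, ?_, fun f => ?_, ?_⟩
  · rw [map_smul, map_smul, hJA', map_smul, derH_pow_affH, smul_smul, smul_smul, ← hpow']
    congr 1
    push_cast
    ring
  · have h1 := hh (A f)
    rw [hJA, map_smul, derH_pow_affH, smul_smul] at h1
    change _ * (derH ^ k) (J f) (affPt y hy x _ ptI) = _ at h1
    rw [inner_smul_left, ← hAA, hinv, ← h1, Complex.conj_ofReal, ← mul_assoc]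
    have : ((y ^ (-(s / 2) - k) : ℝ) : ℂ) * (((y ^ (s / 2) : ℝ) : ℂ) * (y : ℂ) ^ k) = 1 := by
      exact_mod_cast hpow
    rw [this, one_mul]
  · rw [norm_smul, Complex.norm_real, Real.norm_of_nonneg (by positivity),
      @norm_eq_sqrt_re_inner ℂ _ _ _ _ (A' h), hAA', ← @norm_eq_sqrt_re_inner ℂ]

lemma affPt_ptI (z : ↥CPos) : affPt (z : ℂ).im z.2 (z : ℂ).re (by simp) ptI = z := by
  refine Subtype.ext ?_
  simp only [affPt, ptI]
  rw [add_comm]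
  exact Complex.re_add_im _

lemma IsomAction.eq_cpow (hA : IsomAction J s) (hJ : Function.Injective J) {k : ℕ} {h : X}
    (hh : ∀ f, (derH ^ k) (J f) ptI = inner ℂ h f) (z : ↥CPos) :
    (derH ^ k) (J h) z = inner ℂ h h *
      (((z : ℂ) + Complex.I) / (2 * Complex.I)) ^ (-((s + 2 * k : ℝ) : ℂ)) := by
  rw [← hh]
  refine eq_cpow_of_ode (exists_homogeneous_ode fun x y hy => ?_) z
  obtain ⟨h', hh', hf, -⟩ := hA.exists_kernel hJ hh x y hy
  have h1 := hf h
  rw [← inner_conj_symm, ← hh, hh'] at h1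
  rw [← extH_coe (((derH ^ k) (J h)).1) (affPt y hy x _ ptI)] at h1
  convert h1 using 2
  · simp [affPt, ptI, add_comm]
  · show _ = _ * (derH ^ k) (J h) _
    rw [← extH_coe ((derH ^ k) (J h)).1]
    congr 2
    have : (y : ℂ) ≠ 0 := by exact_mod_cast hy.ne'
    simp only [affPt, ptI]
    push_cast
    field_simp
    ring

lemma ofReal_mul_cpow {a : ℝ} (ha : 0 < a) {x : ℂ} (hx : x ≠ 0) (r : ℂ) :
    ((a : ℂ) * x) ^ r = (a : ℂ) ^ r * x ^ r := by
  have hac : (a : ℂ) ≠ 0 := Complex.ofReal_ne_zero.2 ha.ne'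
  rw [Complex.cpow_def_of_ne_zero (mul_ne_zero hac hx), Complex.cpow_def_of_ne_zero hac,
    Complex.cpow_def_of_ne_zero hx, Complex.log_ofReal_mul ha hx, Complex.ofReal_log ha.le,
    add_mul, Complex.exp_add]

theorem IsomAction.classification [CompleteSpace X] (hA : IsomAction J s)
    (hJ : Function.Injective J)
    (hsep : ∀ f, ‖f‖ ≠ 0 → ∃ L, BddLoc J L ∧ L (J f) ≠ 0) (hne : ∃ f : X, ‖f‖ ≠ 0) :
    ∃ k : ℕ, 0 ≤ s + 2 * k ∧ ∃ c : ℝ, 0 < c ∧ (∀ f, (derH ^ k) (J f) = 0 → ‖f‖ = 0) ∧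
      ∀ w : ↥CPos, ∃ h : X,
        (∀ z : ↥CPos, (derH ^ k) (J h) z = c * (((z : ℂ) - (starRingEnd ℂ) (w : ℂ)) /
          (2 * Complex.I)) ^ (-((s + 2 * k : ℝ) : ℂ))) ∧
        ∀ f, (derH ^ k) (J f) w = inner ℂ h f := by
  obtain ⟨k, hk, hb⟩ := exists_bddFun_derH_pow (fun x => hA.lifts 1 one_pos x)
    (fun a ha => by simpa using hA.lifts a ha 0) hsep hne
  obtain ⟨h, hh⟩ := exists_riesz hb
  change ∀ f, (derH ^ k) (J f) ptI = inner ℂ h f at hh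
  have hc0 : ‖h‖ ≠ 0 := by
    intro h0
    obtain ⟨f, hf⟩ := hne
    refine hf (hk f (Subtype.ext (funext fun w => ?_)))
    obtain ⟨h', -, hf', hn⟩ := hA.exists_kernel hJ hh (w : ℂ).re (w : ℂ).im w.2
    have h1 := hf' f
    rw [affPt_ptI] at h1
    have h2 := norm_inner_le_norm (𝕜 := ℂ) h' f
    rw [hn, h0, mul_zero, zero_mul] at h2
    exact h1.trans (norm_le_zero_iff.1 h2)
  have hcn : (inner ℂ h h : ℂ) = ((‖h‖ ^ 2 : ℝ) : ℂ) := by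
    rw [inner_self_eq_norm_sq_to_K]
    norm_cast
  have hc : 0 < ‖h‖ ^ 2 := by positivity
  have hker : ∀ w : ↥CPos, ∃ h' : X,
        (∀ z : ↥CPos, (derH ^ k) (J h') z = (‖h‖ ^ 2 : ℝ) *
          (((z : ℂ) - (starRingEnd ℂ) (w : ℂ)) /
          (2 * Complex.I)) ^ (-((s + 2 * k : ℝ) : ℂ))) ∧
        ∀ f, (derH ^ k) (J f) w = inner ℂ h' f := by
    intro w
    have hy : 0 < (w : ℂ).im := w.2
    obtain ⟨h', hh', hf', -⟩ := hA.exists_kernel hJ hh (w : ℂ).re (w : ℂ).im hy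
    simp only [affPt_ptI] at hf'
    refine ⟨h', fun z => ?_, hf'⟩
    rw [hh']
    show _ * (derH ^ k) (J h) _ = _
    rw [hA.eq_cpow hJ hh, hcn, mul_left_comm]
    congr 1
    have hyc : ((w : ℂ).im : ℂ) ≠ 0 := by exact_mod_cast hy.ne'
    set ζ := affPt (w : ℂ).im⁻¹ (inv_pos.2 hy) ((-(w : ℂ).re / (w : ℂ).im : ℝ) : ℂ) (by simp) z
      with hζ
    have hζ0 : ((ζ : ℂ) + Complex.I) / (2 * Complex.I) ≠ 0 := by
      refine div_ne_zero (fun h0 => ?_) (by simp)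
      have h1 : 0 < (ζ : ℂ).im := ζ.2
      have h2 := congrArg Complex.im h0
      simp only [Complex.add_im, Complex.I_im, Complex.zero_im] at h2
      linarith
    rw [Complex.ofReal_cpow hy.le, Complex.ofReal_neg, ← ofReal_mul_cpow hy hζ0]
    congr 1
    rw [← mul_div_assoc]
    congr 1
    conv_rhs => rw [← Complex.re_add_im (w : ℂ)]
    simp only [hζ, affPt, map_add, map_mul, Complex.conj_ofReal, Complex.conj_I]
    push_cast
    field_simp
    ring
  refine ⟨k, ?_, ‖h‖ ^ 2, hc, hk, hker⟩
  obtain ⟨h', hh', hf', hn⟩ := hA.exists_kernel hJ hh 0 2 two_pos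
  have h1 := norm_inner_le_norm (𝕜 := ℂ) h' h
  have hb : (((affPt 2 two_pos (0 : ℝ) (by simp) ptI : ↥CPos) : ℂ) + Complex.I) /
      (2 * Complex.I) = ((3 / 2 : ℝ) : ℂ) := by
    rw [div_eq_iff (by simp)]
    simp only [affPt, ptI]
    push_cast
    ring
  rw [← hf', hA.eq_cpow hJ hh, hcn, hb, hn, ← Complex.ofReal_neg, ← Complex.ofReal_cpow (by norm_num),
    ← Complex.ofReal_mul, Complex.norm_real, Real.norm_of_nonneg (by positivity)] at h1
  have h2 : (3 / 2 : ℝ) ^ (-(s + 2 * k)) ≤ 2 ^ (-(s / 2) - k) := by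
    refine le_of_mul_le_mul_left ?_ hc
    linarith
  by_contra! hneg
  have h3 : (2 : ℝ) ^ (-(s / 2) - k) = (2 ^ (1 / 2 : ℝ)) ^ (-(s + 2 * k)) := by
    rw [← Real.rpow_mul (by norm_num)]
    congr 1
    ring
  rw [h3, ← Real.sqrt_eq_rpow] at h2
  refine absurd h2 (not_le.2 (Real.rpow_lt_rpow (by positivity) ?_ (by linarith)))
  rw [Real.sqrt_lt' (by norm_num)]
  norm_num

end Abstract

lemma exists_kernel_of_core {X : Type*} [AddCommGroup X] [Module ℂ X]
    (core : PreInnerProductSpace.Core ℂ X) {n : X → ℝ}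
    (hn : ∀ f, n f = Real.sqrt (core.inner f f).re)
    (hcomplete : ∀ u : ℕ → X, (∀ ε : ℝ, 0 < ε → ∃ M : ℕ, ∀ i ≥ M, ∀ j ≥ M, n (u i - u j) ≤ ε) →
      ∃ f, ∀ ε : ℝ, 0 < ε → ∃ M : ℕ, ∀ i ≥ M, n (u i - f) ≤ ε)
    {J : X →ₗ[ℂ] ↥HolH} (hJ : Function.Injective J) {s : ℝ}
    (hne : ∃ f, n f ≠ 0) (W : Submodule ℂ ↥HolH)
    (hclosed : ∀ f : ↥HolH, (∀ K : Set ↥CPos, IsCompact K → ∀ ε : ℝ, 0 < ε →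
      ∃ g ∈ W, ∀ z ∈ K, ‖f z - g z‖ ≤ ε) → f ∈ W)
    (hcont : ∀ K : Set ↥CPos, IsCompact K → ∃ C : ℝ, 0 < C ∧ ∀ f : X, ∀ ε : ℝ, 0 < ε →
      ∃ g ∈ W, ∀ z ∈ K, ‖J f z - g z‖ ≤ C * n f + ε)
    (hW : ∀ f, n f ≠ 0 → J f ∉ W)
    (hA : ∀ (a : ℝ) (ha : 0 < a) (b : ℝ), ∃ A : X → X,
      (∀ f, J (A f) = ((a ^ (s / 2) : ℝ) : ℂ) • affH a ha b (by simp) (J f)) ∧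
      ∀ f g, core.inner (A f) (A g) = core.inner f g) :
    ∃ k : ℕ, 0 ≤ s + 2 * k ∧ ∃ c : ℝ, 0 < c ∧ (∀ f, (derH ^ k) (J f) = 0 → n f = 0) ∧
      ∀ w : ↥CPos, ∃ h : X,
        (∀ z : ↥CPos, (derH ^ k) (J h) z = c * (((z : ℂ) - (starRingEnd ℂ) (w : ℂ)) /
          (2 * Complex.I)) ^ (-((s + 2 * k : ℝ) : ℂ))) ∧
        ∀ f, (derH ^ k) (J f) w = core.inner h f := by
  let : SeminormedAddCommGroup X := @InnerProductSpace.Core.toSeminormedAddCommGroup ℂ X _ _ _ core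
  let : InnerProductSpace ℂ X := InnerProductSpace.ofCore core
  have hnorm : ∀ f : X, n f = ‖f‖ := hn
  simp only [hnorm] at *
  have : CompleteSpace X := by
    refine Metric.complete_of_cauchySeq_tendsto fun u hu => ?_
    rw [Metric.cauchySeq_iff] at hu
    obtain ⟨f, hf⟩ := hcomplete u fun ε hε => by
      obtain ⟨N, hN⟩ := hu ε hε
      exact ⟨N, fun i hi j hj => by rw [← dist_eq_norm]; exact (hN i hi j hj).le⟩
    refine ⟨f, Metric.tendsto_atTop.2 fun ε hε => ?_⟩
    obtain ⟨N, hN⟩ := hf (ε / 2) (half_pos hε)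
    exact ⟨N, fun i hi => by rw [dist_eq_norm]; exact (hN i hi).trans_lt (half_lt_self hε)⟩
  exact IsomAction.classification hA hJ
    (fun f hf => exists_bddLoc_map_ne_zero W hclosed hcont (hW f hf)) hne

/-- classification of the strongly decent semi-Hilbert spaces of
holomorphic functions on `ℂ₊` on which the weighted affine action `U_s` is
isometric: for some `k ∈ ℕ` with `s + 2k ≥ 0`, the null space of `H` is
`H ∩ ker ∂^k` and `∂^k` maps `H` onto the reproducing kernel Hilbert space with
kernel proportional to `((z - conj w)/(2i))^{-(s+2k)}`. -/
theorem stmt_11 (s : ℝ)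
    (H : Set (↥CPos → ℂ)) (p : (↥CPos → ℂ) → (↥CPos → ℂ) → ℂ)
    -- `H` is a linear subspace of `Hol(ℂ₊)`
    (hholo : ∀ f ∈ H, HoloOnH f)
    (hH0 : (0 : ↥CPos → ℂ) ∈ H)
    (hHadd : ∀ f ∈ H, ∀ g ∈ H, f + g ∈ H)
    (hHsmul : ∀ (c : ℂ), ∀ f ∈ H, c • f ∈ H)
    -- `p` is a positive semidefinite hermitian sesquilinear form on `H`
    (hpherm : ∀ f ∈ H, ∀ g ∈ H, p f g = (starRingEnd ℂ) (p g f))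
    (hpadd : ∀ f ∈ H, ∀ g ∈ H, ∀ h ∈ H, p (f + g) h = p f h + p g h)
    (hpsmul : ∀ (a : ℂ), ∀ f ∈ H, ∀ g ∈ H, p (a • f) g = a * p f g)
    (hppos : ∀ f ∈ H, (p f f).im = 0 ∧ 0 ≤ (p f f).re)
    -- `H` is complete for the seminorm associated with `p`
    (hcomplete : ∀ u : ℕ → (↥CPos → ℂ), (∀ i, u i ∈ H) →
      (∀ ε : ℝ, 0 < ε → ∃ M : ℕ, ∀ i ≥ M, ∀ j ≥ M,
        Real.sqrt (p (u i - u j) (u i - u j)).re ≤ ε) →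
      ∃ f ∈ H, ∀ ε : ℝ, 0 < ε → ∃ M : ℕ, ∀ i ≥ M,
        Real.sqrt (p (u i - f) (u i - f)).re ≤ ε)
    -- (i) the seminorm of `H` is nonzero
    (hne : ∃ f ∈ H, Real.sqrt (p f f).re ≠ 0)
    -- (ii) strong decency: `V` is a closed subspace of `Hol(ℂ₊)` with
    -- `H ∩ V` the null space of `H`, and `H → Hol(ℂ₊)/V` is continuous
    (V : Set (↥CPos → ℂ))
    (hVholo : ∀ f ∈ V, HoloOnH f)
    (hV0 : (0 : ↥CPos → ℂ) ∈ V)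
    (hVadd : ∀ f ∈ V, ∀ g ∈ V, f + g ∈ V)
    (hVsmul : ∀ (c : ℂ), ∀ f ∈ V, c • f ∈ V)
    (hVclosed : ∀ f, HoloOnH f → MemClosureH V f → f ∈ V)
    (hHV : H ∩ V = {f | f ∈ H ∧ Real.sqrt (p f f).re = 0})
    (hquotcont : ∀ K : Set ↥CPos, IsCompact K → ∃ C : ℝ, 0 < C ∧
      ∀ f ∈ H, ∀ ε : ℝ, 0 < ε → ∃ g ∈ V, ∀ z ∈ K,
        ‖f z - g z‖ ≤ C * Real.sqrt (p f f).re + ε)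
    -- (iii) the weighted affine action `U_s` is isometric on `H`
    (hτ : ∀ x : ℝ,
      (∀ f ∈ H, (fun z => f (transH x z)) ∈ H) ∧
      (∀ f ∈ H, ∀ g ∈ H,
        p (fun z => f (transH x z)) (fun z => g (transH x z)) = p f g))
    (hδ : ∀ (l : ℝ) (hl : 0 < l),
      (∀ f ∈ H, (fun z => ((l ^ (s / 2) : ℝ) : ℂ) * f (dilH l hl z)) ∈ H) ∧
      (∀ f ∈ H, ∀ g ∈ H,
        p (fun z => ((l ^ (s / 2) : ℝ) : ℂ) * f (dilH l hl z))
          (fun z => ((l ^ (s / 2) : ℝ) : ℂ) * g (dilH l hl z)) = p f g)) :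
    ∃ k : ℕ, 0 ≤ s + 2 * k ∧ ∃ c : ℝ, 0 < c ∧
      (∀ f ∈ H, (pdH^[k] f = 0) → Real.sqrt (p f f).re = 0) ∧
      (∀ w : ↥CPos, ∃ hw ∈ H,
        (∀ z : ↥CPos,
          pdH^[k] hw z
            = c * (((z : ℂ) - (starRingEnd ℂ) (w : ℂ)) / (2 * Complex.I))
                ^ (-((s + 2 * k : ℝ) : ℂ))) ∧
        ∀ f ∈ H, pdH^[k] f w = p f hw) := by
  let X : Submodule ℂ (↥CPos → ℂ) :=
    { carrier := H
      add_mem' := fun hf hg => hHadd _ hf _ hg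
      zero_mem' := hH0
      smul_mem' := fun c _ hf => hHsmul c _ hf }
  let core : PreInnerProductSpace.Core ℂ X :=
    { inner := fun f g => p g.1 f.1
      conj_inner_symm := fun f g => (hpherm _ g.2 _ f.2).symm
      re_inner_nonneg := fun f => (hppos _ f.2).2
      add_left := fun f g h => by
        show p h.1 (f.1 + g.1) = p h.1 f.1 + p h.1 g.1
        rw [hpherm _ h.2 _ (hHadd _ f.2 _ g.2), hpadd _ f.2 _ g.2 _ h.2, map_add,
          ← hpherm _ h.2 _ f.2, ← hpherm _ h.2 _ g.2]
      smul_left := fun f g c => by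
        show p g.1 (c • f.1) = (starRingEnd ℂ) c * p g.1 f.1
        rw [hpherm _ g.2 _ (hHsmul c _ f.2), hpsmul _ _ f.2 _ g.2, map_mul,
          ← hpherm _ g.2 _ f.2] }
  let J : X →ₗ[ℂ] ↥HolH := Submodule.inclusion hholo
  let W : Submodule ℂ ↥HolH :=
    { carrier := {f | f.1 ∈ V}
      add_mem' := fun hf hg => hVadd _ hf _ hg
      zero_mem' := hV0
      smul_mem' := fun c _ hf => hVsmul c _ hf }
  obtain ⟨k, hk, c, hc, hker, hrep⟩ := exists_kernel_of_core (s := s) core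
    (n := fun f => Real.sqrt (p f.1 f.1).re) (fun _ => rfl)
    (fun u hu => by
      obtain ⟨f, hf, hfu⟩ := hcomplete (fun i => (u i).1) (fun i => (u i).2) hu
      exact ⟨⟨f, hf⟩, hfu⟩)
    (J := J) (Submodule.inclusion_injective hholo)
    (by
      obtain ⟨f, hf, hf0⟩ := hne
      exact ⟨⟨f, hf⟩, hf0⟩)
    W
    (fun f hf => hVclosed f.1 f.2 fun K hK ε hε => by
      obtain ⟨g, hg, hfg⟩ := hf K hK ε hε
      exact ⟨g.1, hg, hfg⟩)
    (fun K hK => by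
      obtain ⟨C, hC0, hC⟩ := hquotcont K hK
      refine ⟨C, hC0, fun f ε hε => ?_⟩
      obtain ⟨g, hg, hfg⟩ := hC f.1 f.2 ε hε
      exact ⟨⟨g, hVholo g hg⟩, hg, hfg⟩)
    (fun f hf hfV => hf (hHV.subset ⟨f.2, hfV⟩).2)
    (fun a ha b => by
      refine ⟨fun f => ⟨_, (hδ a ha).1 _ ((hτ b).1 _ f.2)⟩, fun f => rfl, fun f g => ?_⟩
      exact ((hδ a ha).2 _ ((hτ b).1 _ g.2) _ ((hτ b).1 _ f.2)).trans ((hτ b).2 _ g.2 _ f.2))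
  refine ⟨k, hk, c, hc, fun f hf hkf => hker ⟨f, hf⟩ (Subtype.ext ?_), fun w => ?_⟩
  · rw [derH_pow_coe]
    exact hkf
  · obtain ⟨h, hh, hf⟩ := hrep w
    refine ⟨h.1, h.2, fun z => ?_, fun f hfH => ?_⟩
    · rw [← hh z, derH_pow_coe]
      rfl
    · have := hf ⟨f, hfH⟩
      rw [derH_pow_coe] at this
      exact this
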